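/- arXiv:math/0608453 — 2 statements merged into one kernel-verified Lean document; each statement's English description precedes it below -/
import Mathlib

section
/- For every finite simple graph G of order n ≥ 1 and every integer r ≥ 2, the number of (r+1)-cliques satisfies k_{r+1}(G) ≥ (μ(G)/n − 1 + 1/r) · (r(r−1)/(r+1)) · (n/r)^{r+1}. -/
open Finset

/-- The number of `k`-walks in `G`: sequences `v₁, …, v_k` of vertices of `G` such that
consecutive vertices are adjacent. -/
noncomputable def walkCount {V : Type*} [Fintype V] (G : SimpleGraph V) (k : ℕ) : ℕ :=
  Nat.card {f : Fin k → V //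
    ∀ (i : ℕ) (h : i + 1 < k), G.Adj (f ⟨i, Nat.lt_of_succ_lt h⟩) (f ⟨i + 1, h⟩)}

/-- The number of `k`-walks in `G` starting at the vertex `u`. -/
noncomputable def walkCountFrom {V : Type*} [Fintype V] (G : SimpleGraph V) (u : V) (k : ℕ) : ℕ :=
  Nat.card {f : Fin k → V //
    (∀ (h : 0 < k), f ⟨0, h⟩ = u) ∧
    ∀ (i : ℕ) (h : i + 1 < k), G.Adj (f ⟨i, Nat.lt_of_succ_lt h⟩) (f ⟨i + 1, h⟩)}

/-- The number of `s`-cliques of `G`. -/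
def cliqueCount {V : Type*} [Fintype V] [DecidableEq V] (G : SimpleGraph V) [DecidableRel G.Adj]
    (s : ℕ) : ℕ :=
  (G.cliqueFinset s).card

/-- The number of `s`-cliques of `G` containing the vertex `u`. -/
def cliqueCountOn {V : Type*} [Fintype V] [DecidableEq V] (G : SimpleGraph V) [DecidableRel G.Adj]
    (u : V) (s : ℕ) : ℕ :=
  ((G.cliqueFinset s).filter (fun t => u ∈ t)).card

lemma adjMatrix_isHermitian {V : Type*} [Fintype V] [DecidableEq V] (G : SimpleGraph V)
    [DecidableRel G.Adj] : (G.adjMatrix ℝ).IsHermitian := by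
  rw [Matrix.IsHermitian, Matrix.conjTranspose_eq_transpose_of_trivial]
  exact SimpleGraph.isSymm_adjMatrix G

/-- The largest eigenvalue (spectral radius) of the adjacency matrix of `G`. -/
noncomputable def adjSpectralRadius {V : Type*} [Fintype V] [DecidableEq V] (G : SimpleGraph V)
    [DecidableRel G.Adj] : ℝ :=
  ⨆ i, (adjMatrix_isHermitian G).eigenvalues i

/-- Common neighbourhood of a vertex set. -/
def cnbr {V : Type*} [Fintype V] (G : SimpleGraph V) [DecidableRel G.Adj] (C : Finset V) :
    Finset V := univ.filter (fun u => ∀ v ∈ C, G.Adj u v)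

lemma clique_double {V : Type*} [Fintype V] [DecidableEq V]
    (G : SimpleGraph V) [DecidableRel G.Adj] (s : ℕ) (f : Finset V → V → ℝ) :
    ∑ C ∈ G.cliqueFinset s, ∑ u ∈ cnbr G C, f C u =
      ∑ A ∈ G.cliqueFinset (s + 1), ∑ u ∈ A, f (A.erase u) u := by
  rw [Finset.sum_sigma', Finset.sum_sigma']
  refine Finset.sum_bij' (fun p _ => ⟨insert p.2 p.1, p.2⟩) (fun p _ => ⟨p.1.erase p.2, p.2⟩)
    ?_ ?_ ?_ ?_ ?_
  · rintro ⟨C, u⟩ h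
    simp only [mem_sigma, SimpleGraph.mem_cliqueFinset_iff, cnbr, mem_filter, mem_univ,
      true_and] at h ⊢
    exact ⟨h.1.insert h.2, mem_insert_self _ _⟩
  · rintro ⟨A, u⟩ h
    simp only [mem_sigma, SimpleGraph.mem_cliqueFinset_iff, cnbr, mem_filter, mem_univ,
      true_and] at h ⊢
    obtain ⟨h1, h2⟩ := h
    refine ⟨⟨?_, ?_⟩, ?_⟩
    · exact h1.isClique.subset (by simp)
    · rw [card_erase_of_mem h2, h1.card_eq]; rfl
    · intro v hv
      exact h1.isClique (by simpa using h2) (by simpa using mem_of_mem_erase hv)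
        (ne_of_mem_erase hv).symm
  · rintro ⟨C, u⟩ h
    simp only [mem_sigma, SimpleGraph.mem_cliqueFinset_iff, cnbr, mem_filter, mem_univ,
      true_and] at h
    have : u ∉ C := fun hu => G.irrefl (h.2 u hu)
    simp [erase_insert this]
  · rintro ⟨A, u⟩ h
    simp only [mem_sigma] at h
    simp [insert_erase h.2]
  · rintro ⟨C, u⟩ h
    simp only [mem_sigma, SimpleGraph.mem_cliqueFinset_iff, cnbr, mem_filter, mem_univ,
      true_and] at h
    have : u ∉ C := fun hu => G.irrefl (h.2 u hu)
    simp [erase_insert this]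

lemma sum_cnbr {V : Type*} [Fintype V] [DecidableEq V]
    (G : SimpleGraph V) [DecidableRel G.Adj] (s : ℕ) :
    ∑ C ∈ G.cliqueFinset s, ((cnbr G C).card : ℝ) = (s + 1) * cliqueCount G (s + 1) := by
  have h := clique_double G s (fun _ _ => 1)
  simp only [sum_const, nsmul_eq_mul, mul_one] at h
  rw [h, Finset.sum_congr rfl (g := fun _ => (s + 1 : ℝ))]
  · rw [sum_const, nsmul_eq_mul, cliqueCount, mul_comm]
  · intro A hA
    rw [SimpleGraph.mem_cliqueFinset_iff] at hA
    rw [hA.card_eq]; push_cast; ring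

lemma local_mm {V : Type*} [Fintype V] [DecidableEq V]
    (G : SimpleGraph V) [DecidableRel G.Adj] (s : ℕ) (A : Finset V) (hA : A.card = s + 1) :
    ∑ u ∈ A, ((cnbr G (A.erase u)).card : ℝ) ≤ Fintype.card V + s * (cnbr G A).card := by
  have h1 : ∑ u ∈ A, ((cnbr G (A.erase u)).card) =
      ∑ w : V, (A.filter (fun u => w ∈ cnbr G (A.erase u))).card := by
    simp only [card_eq_sum_ones, sum_filter]
    rw [Finset.sum_comm]
    refine sum_congr rfl fun u _ => ?_
    rw [← sum_filter]
    congr 1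
    ext; simp
  have h2 : ∑ u ∈ A, ((cnbr G (A.erase u)).card) ≤
      ∑ w : V, (1 + if w ∈ cnbr G A then s else 0) := by
    rw [h1]
    refine sum_le_sum fun w _ => ?_
    split_ifs with hw
    · calc _ ≤ A.card := card_filter_le _ _
        _ = _ := by omega
    · simp only [cnbr, mem_filter, mem_univ, true_and, not_forall] at hw
      obtain ⟨v, hv, hvw⟩ := hw
      rw [add_zero, card_le_one]
      have key : ∀ a ∈ A.filter (fun u => w ∈ cnbr G (A.erase u)), a = v := by
        intro a ha
        simp only [cnbr, mem_filter, mem_univ, true_and] at ha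
        by_contra hne
        exact hvw (ha.2 v (mem_erase.2 ⟨fun h => hne h.symm, hv⟩))
      intro a ha b hb
      rw [key a ha, key b hb]
  have h3 : ∑ w : V, (1 + if w ∈ cnbr G A then s else 0) =
      Fintype.card V + s * (cnbr G A).card := by
    rw [sum_add_distrib, ← sum_filter]
    simp [mul_comm]
  rw [h3] at h2
  exact_mod_cast h2

/-- Moon–Moser inequality. -/
lemma moon_moser {V : Type*} [Fintype V] [DecidableEq V]
    (G : SimpleGraph V) [DecidableRel G.Adj] (s : ℕ) :
    ((s + 1 : ℝ) * cliqueCount G (s + 1)) ^ 2 ≤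
      cliqueCount G s * ((Fintype.card V : ℝ) * cliqueCount G (s + 1) +
        s * ((s + 2) * cliqueCount G (s + 2))) := by
  have h1 := sum_cnbr G s
  have h2 := clique_double G s (fun C _ => ((cnbr G C).card : ℝ))
  have h3 : ∑ A ∈ G.cliqueFinset (s + 1), ∑ u ∈ A, ((cnbr G (A.erase u)).card : ℝ) ≤
      ∑ A ∈ G.cliqueFinset (s + 1), (Fintype.card V + s * ((cnbr G A).card : ℝ)) := by
    refine sum_le_sum fun A hA => ?_
    rw [SimpleGraph.mem_cliqueFinset_iff] at hA
    exact local_mm G s A hA.card_eq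
  rw [← h2, sum_add_distrib, ← mul_sum, sum_cnbr G (s + 1)] at h3
  simp only [sum_const, nsmul_eq_mul] at h3
  have h4 := sq_sum_le_card_mul_sum_sq (s := G.cliqueFinset s)
    (f := fun C => ((cnbr G C).card : ℝ))
  rw [h1] at h4
  refine h4.trans ?_
  unfold cliqueCount at *
  refine mul_le_mul_of_nonneg_left ?_ (by positivity)
  simp only [sq]
  push_cast at h3
  linarith

/-- Weighted clique sums. -/
noncomputable def wsum {V : Type*} [Fintype V] [DecidableEq V]
    (G : SimpleGraph V) [DecidableRel G.Adj] (x : V → ℝ) (s : ℕ) : ℝ :=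
  ∑ A ∈ G.cliqueFinset s, ∑ v ∈ A, x v

lemma wsum_step {V : Type*} [Fintype V] [DecidableEq V]
    (G : SimpleGraph V) [DecidableRel G.Adj] (x : V → ℝ) (hx : ∀ v, 0 ≤ x v) (μ : ℝ)
    (hμ : ∀ v, μ * x v ≤ ∑ u, if G.Adj u v then x u else 0) (s : ℕ) :
    μ * wsum G x (s + 1) ≤ wsum G x (s + 2) + s * cliqueCount G (s + 1) * ∑ v, x v := by
  have h2 := clique_double G (s + 1) (fun _ u => x u)
  have e : wsum G x (s + 2) = ∑ A ∈ G.cliqueFinset (s + 1), ∑ u ∈ cnbr G A, x u := h2.symm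
  have e2 : wsum G x (s + 2) + s * cliqueCount G (s + 1) * ∑ v, x v =
      ∑ A ∈ G.cliqueFinset (s + 1), (∑ u ∈ cnbr G A, x u + s * ∑ v, x v) := by
    rw [e, sum_add_distrib, sum_const, nsmul_eq_mul, cliqueCount]
    ring
  rw [e2, wsum, mul_sum]
  refine sum_le_sum fun A hA => ?_
  rw [SimpleGraph.mem_cliqueFinset_iff] at hA
  have hc := hA.card_eq
  calc μ * ∑ v ∈ A, x v = ∑ v ∈ A, μ * x v := mul_sum _ _ _
    _ ≤ ∑ v ∈ A, ∑ u, (if G.Adj u v then x u else 0) := sum_le_sum fun v _ => hμ v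
    _ = ∑ u, ((A.filter (fun v => G.Adj u v)).card : ℝ) * x u := by
        rw [Finset.sum_comm]
        refine sum_congr rfl fun u _ => ?_
        rw [← sum_filter, sum_const, nsmul_eq_mul]
    _ ≤ ∑ u, ((if u ∈ cnbr G A then x u else 0) + s * x u) := by
        refine sum_le_sum fun u _ => ?_
        split_ifs with hu
        · have : ((A.filter (fun v => G.Adj u v)).card : ℝ) ≤ s + 1 := by
            have := card_filter_le A (fun v => G.Adj u v)
            rw [hc] at this
            exact_mod_cast this
          nlinarith [hx u]
        · have : ((A.filter (fun v => G.Adj u v)).card : ℝ) ≤ s := by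
            simp only [cnbr, mem_filter, mem_univ, true_and, not_forall] at hu
            obtain ⟨v, hv, hvw⟩ := hu
            have : (A.filter (fun v => G.Adj u v)).card < A.card :=
              card_lt_card (filter_ssubset.2 ⟨v, hv, hvw⟩)
            have : (A.filter (fun v => G.Adj u v)).card ≤ s := by omega
            exact_mod_cast this
          nlinarith [hx u]
    _ = _ := by
        rw [sum_add_distrib, ← mul_sum, ← sum_filter]
        congr 2
        ext; simp

lemma wsum_last {V : Type*} [Fintype V] [DecidableEq V]
    (G : SimpleGraph V) [DecidableRel G.Adj] (x : V → ℝ) (hx : ∀ v, 0 ≤ x v) (μ : ℝ)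
    (hμ : ∀ v, μ * x v ≤ ∑ u, if G.Adj u v then x u else 0) (s : ℕ) :
    μ * wsum G x s ≤ s * cliqueCount G s * ∑ v, x v := by
  rw [wsum, mul_sum]
  calc _ ≤ ∑ A ∈ G.cliqueFinset s, (s * ∑ v, x v) := by
        refine sum_le_sum fun A hA => ?_
        rw [SimpleGraph.mem_cliqueFinset_iff] at hA
        rw [mul_sum]
        calc _ ≤ ∑ v ∈ A, ∑ v, x v := by
              refine sum_le_sum fun v _ => (hμ v).trans (sum_le_sum fun u _ => ?_)
              split_ifs
              · exact le_rfl
              · exact hx u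
          _ = _ := by rw [sum_const, nsmul_eq_mul, hA.card_eq]
    _ = _ := by rw [sum_const, nsmul_eq_mul, cliqueCount]; ring

lemma exists_weight {V : Type*} [Fintype V] [DecidableEq V] [Nonempty V]
    (G : SimpleGraph V) [DecidableRel G.Adj] :
    ∃ x : V → ℝ, (∀ v, 0 ≤ x v) ∧ 0 < ∑ v, x v ∧
      ∀ v, adjSpectralRadius G * x v ≤ ∑ u, if G.Adj u v then x u else 0 := by
  obtain ⟨i, hi⟩ := exists_eq_ciSup_of_finite (f := (adjMatrix_isHermitian G).eigenvalues)
  have hi' : adjSpectralRadius G = (adjMatrix_isHermitian G).eigenvalues i := hi.symm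
  have hv := (adjMatrix_isHermitian G).mulVec_eigenvectorBasis i
  have hne : (adjMatrix_isHermitian G).eigenvectorBasis i ≠ 0 :=
    (adjMatrix_isHermitian G).eigenvectorBasis.orthonormal.ne_zero i
  rw [← hi'] at hv
  set z := (adjMatrix_isHermitian G).eigenvectorBasis i
  refine ⟨fun v => |z v|, fun v => abs_nonneg _, ?_, ?_⟩
  · obtain ⟨v, hv⟩ : ∃ v, z v ≠ 0 := by
      by_contra! h
      exact hne (by ext v; simpa using h v)
    exact sum_pos' (fun v _ => abs_nonneg _) ⟨v, mem_univ _, abs_pos.2 hv⟩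
  · intro v
    have h := congrFun hv v
    rw [SimpleGraph.adjMatrix_mulVec_apply] at h
    simp only [Pi.smul_apply, smul_eq_mul] at h
    calc _ ≤ |adjSpectralRadius G * z v| := by
          rw [abs_mul]
          exact mul_le_mul_of_nonneg_right (le_abs_self _) (abs_nonneg _)
      _ = |∑ u ∈ G.neighborFinset v, z u| := by rw [h]
      _ ≤ ∑ u ∈ G.neighborFinset v, |z u| := abs_sum_le_sum_abs _ _
      _ = _ := by
          rw [← sum_filter]
          refine sum_congr ?_ fun _ _ => rfl
          ext u; simp [G.adj_comm]

/-- The comparison sequence. -/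
noncomputable def KK (n y : ℝ) : ℕ → ℝ
  | 0 => 1
  | s + 1 => KK n y s * (n - s * y) / (s + 1)

lemma KK_succ (n y : ℝ) (s : ℕ) : (s + 1) * KK n y (s + 1) = KK n y s * (n - s * y) := by
  have : (s + 1 : ℝ) ≠ 0 := by positivity
  rw [KK]; field_simp

lemma KK_ge (n y : ℝ) (r : ℕ) (hr : 2 ≤ r) (hn : 0 < n) (hy : r * y ≤ n) (s : ℕ) (hs : s ≤ r) :
    (r.choose s : ℝ) * (n / r) ^ s ≤ KK n y s := by
  have hr0 : (0 : ℝ) < r := by positivity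
  induction s with
  | zero => simp [KK]
  | succ s ih =>
    have ih := ih (by omega)
    have h1 : (s + 1 : ℝ) * (r.choose (s + 1)) = r.choose s * (r - s) := by
      have := Nat.choose_succ_right_eq r s
      have h2 : ((r - s : ℕ) : ℝ) = r - s := by push_cast [Nat.cast_sub (show s ≤ r by omega)]; ring
      rw [← h2]
      exact_mod_cast (by linarith : (s + 1) * r.choose (s + 1) = r.choose s * (r - s))
    have hsr : (s : ℝ) + 1 ≤ r := by exact_mod_cast hs
    have hy' : y ≤ n / r := by rw [le_div_iff₀ hr0]; linarith
    have h3 : (r - s) * (n / r) ≤ n - s * y := by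
      have : (r : ℝ) * (n / r) = n := by field_simp
      nlinarith [(Nat.cast_nonneg s : (0 : ℝ) ≤ s)]
    have hnr : 0 < n / r := by positivity
    have hp : (0 : ℝ) ≤ (r.choose s : ℝ) * (n / r) ^ s := by positivity
    have h4 : (r.choose s : ℝ) * (n / r) ^ s * ((r - s) * (n / r)) ≤ KK n y s * (n - s * y) :=
      mul_le_mul ih h3 (mul_nonneg (by linarith) hnr.le) (hp.trans ih)
    rw [← KK_succ] at h4
    have h5 : (r.choose s : ℝ) * (n / r) ^ s * ((r - s) * (n / r)) =
        (s + 1) * ((r.choose (s + 1)) * (n / r) ^ (s + 1)) := by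
      linear_combination (-(n / r) ^ (s + 1)) * h1
    rw [h5] at h4
    exact le_of_mul_le_mul_left h4 (by positivity)

lemma cliqueCount_one' {V : Type*} [Fintype V] [DecidableEq V]
    (G : SimpleGraph V) [DecidableRel G.Adj] : (cliqueCount G 1 : ℝ) = Fintype.card V := by
  have h := sum_cnbr G 0
  have : G.cliqueFinset 0 = {∅} := by ext; simp [SimpleGraph.mem_cliqueFinset_iff]
  rw [this] at h
  simp [cnbr] at h
  exact_mod_cast h.symm

lemma wsum_one {V : Type*} [Fintype V] [DecidableEq V]
    (G : SimpleGraph V) [DecidableRel G.Adj] (x : V → ℝ) : wsum G x 1 = ∑ v, x v := by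
  have h := clique_double G 0 (fun _ u => x u)
  have : G.cliqueFinset 0 = {∅} := by ext; simp [SimpleGraph.mem_cliqueFinset_iff]
  rw [this] at h
  simp [cnbr] at h
  exact h.symm

/-- Once a clique count exceeds the comparison sequence, it keeps doing so. -/
lemma mm_step {V : Type*} [Fintype V] [DecidableEq V]
    (G : SimpleGraph V) [DecidableRel G.Adj] (y : ℝ) (s : ℕ) (hs : 1 ≤ s)
    (h0 : 0 < cliqueCount G (s + 1))
    (h : (Fintype.card V - s * y) * cliqueCount G s ≤ (s + 1) * cliqueCount G (s + 1)) :
    (Fintype.card V - (s + 1) * y) * cliqueCount G (s + 1) ≤ (s + 2) * cliqueCount G (s + 2) := by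
  have hmm := moon_moser G s
  have h0' : (0 : ℝ) < cliqueCount G (s + 1) := by exact_mod_cast h0
  have hs' : (1 : ℝ) ≤ s := by exact_mod_cast hs
  have hks : (0 : ℝ) < cliqueCount G s := by
    rcases (Nat.cast_nonneg (cliqueCount G s) : (0 : ℝ) ≤ cliqueCount G s).lt_or_eq with h | h
    · exact h
    · rw [← h, zero_mul] at hmm
      have : 0 < ((s + 1 : ℝ) * cliqueCount G (s + 1)) ^ 2 := by positivity
      linarith
  generalize (cliqueCount G (s + 1) : ℝ) = b at *
  generalize (cliqueCount G (s + 2) : ℝ) = c at *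
  generalize (cliqueCount G s : ℝ) = a at *
  generalize (Fintype.card V : ℝ) = n at *
  have h1 : ((s + 1) * b) * ((n - s * y) * a) ≤ ((s + 1) * b) ^ 2 := by
    rw [sq]; exact mul_le_mul_of_nonneg_left h (by positivity)
  have h2 : (a * s) * ((n - (s + 1) * y) * b) ≤ (a * s) * ((s + 2) * c) := by nlinarith
  exact le_of_mul_le_mul_left h2 (by positivity)

/-- **Bollobás–Nikiforov, Theorem 2.** For every graph `G` of order `n ≥ 1` and every `r ≥ 2`,
`k_{r+1}(G) ≥ (μ(G)/n − 1 + 1/r) · (r(r−1)/(r+1)) · (n/r)^{r+1}`. -/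
theorem cliqueCount_ge_of_spectral_radius {V : Type*} [Fintype V] [DecidableEq V]
    (G : SimpleGraph V) [DecidableRel G.Adj] (r : ℕ) (hr : 2 ≤ r)
    (n : ℕ) (hn : n = Fintype.card V) (hn1 : 1 ≤ n) :
    (cliqueCount G (r + 1) : ℝ) ≥
      (adjSpectralRadius G / n - 1 + 1 / r) * ((r : ℝ) * ((r : ℝ) - 1) / ((r : ℝ) + 1)) *
        ((n : ℝ) / r) ^ (r + 1) := by
  have hnR : (0 : ℝ) < n := by exact_mod_cast hn1
  have hrR : (2 : ℝ) ≤ r := by exact_mod_cast hr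
  have hne : Nonempty V := Fintype.card_pos_iff.1 (by omega)
  obtain ⟨x, hx0, hxS, hxμ⟩ := exists_weight G
  have hnV : (Fintype.card V : ℝ) = n := by rw [hn]
  set μ := adjSpectralRadius G
  by_cases hδ : μ / n - 1 + 1 / r ≤ 0
  · refine ge_iff_le.2 (le_trans ?_ (Nat.cast_nonneg _))
    rw [mul_assoc]
    refine mul_nonpos_of_nonpos_of_nonneg hδ (mul_nonneg (div_nonneg ?_ ?_) (by positivity))
    · exact mul_nonneg (by linarith) (by linarith)
    · linarith
  push Not at hδ
  obtain ⟨y, hy⟩ : ∃ y : ℝ, y = n - μ := ⟨_, rfl⟩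
  have hid : (n : ℝ) - r * y = r * n * (μ / n - 1 + 1 / r) := by
    rw [hy]; field_simp; ring
  have hpos : 0 < (n : ℝ) - r * y := by rw [hid]; positivity
  have hry : r * y ≤ (n : ℝ) := by linarith
  have hμlow : ((r : ℝ) - 1) * n ≤ r * μ := by nlinarith
  have hμ0 : 0 < μ := by
    have : 0 < r * μ := lt_of_lt_of_le (mul_pos (by linarith) hnR) hμlow
    exact pos_of_mul_pos_right this (by linarith)
  have hK := KK_ge n y r hr hnR hry
  have hKpos : ∀ s ≤ r, 0 < KK n y s := fun s hs =>
    lt_of_lt_of_le (mul_pos (by exact_mod_cast Nat.choose_pos hs) (by positivity)) (hK s hs)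
  have hfac : ∀ s ≤ r, 0 ≤ (n : ℝ) - s * y := by
    intro s hs
    have hsr : (s : ℝ) ≤ r := by exact_mod_cast hs
    rcases le_total y 0 with h | h
    · nlinarith [(Nat.cast_nonneg s : (0 : ℝ) ≤ s)]
    · nlinarith
  have hKr : ((n : ℝ) / r) ^ r ≤ KK n y r := by simpa using hK r le_rfl
  -- the main estimate
  have main : μ * ((n - r * y) * KK n y r) ≤ n * ((r + 1) * cliqueCount G (r + 1)) := by
    by_cases hA : ∀ s, 1 ≤ s → s ≤ r → (cliqueCount G s : ℝ) ≤ KK n y s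
    · have hb : ∀ s, s ≤ r → (s + 1) * KK n y (s + 1) * (∑ v, x v) ≤ n * wsum G x (s + 1) := by
        intro s
        induction s with
        | zero => intro _; rw [zero_add, wsum_one]; simp [KK]
        | succ s ih =>
          intro hs
          have ih := ih (by omega)
          have h1 := wsum_step G x hx0 μ hxμ s
          have h2 := hA (s + 1) (by omega) hs
          have h3 := KK_succ n y (s + 1)
          have h4 : (s : ℝ) * cliqueCount G (s + 1) * (∑ v, x v) ≤
              s * KK n y (s + 1) * (∑ v, x v) := by gcongr
          have h5 := mul_le_mul_of_nonneg_left ih hμ0.le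
          have h6 := mul_le_mul_of_nonneg_left (h1.trans (add_le_add_right h4 _)) hnR.le
          push_cast at h3 ⊢
          rw [h3]
          have h7 : μ = n - y := by linarith
          have h8 : KK n y (s + 1) * (n - (s + 1) * y) * (∑ v, x v) =
              μ * ((s + 1) * KK n y (s + 1) * (∑ v, x v)) -
                n * (s * KK n y (s + 1) * (∑ v, x v)) := by rw [h7]; ring
          rw [h8]
          linarith
      have h1 := hb r le_rfl
      have h2 := wsum_last G x hx0 μ hxμ (r + 1)
      rw [KK_succ] at h1
      have h3 := mul_le_mul_of_nonneg_left h1 hμ0.le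
      have h4 := mul_le_mul_of_nonneg_left h2 hnR.le
      push_cast at h4
      refine le_of_mul_le_mul_right (a := ∑ v, x v) ?_ hxS
      linarith
    · push Not at hA
      obtain ⟨t, ht1, htr, htK⟩ := hA
      have hμn : μ ≤ n := by
        have h1 := wsum_last G x hx0 μ hxμ 1
        rw [wsum_one, cliqueCount_one', hnV] at h1
        push_cast at h1
        rw [one_mul] at h1
        exact le_of_mul_le_mul_right h1 hxS
      have hP : ∀ s, 1 ≤ s → s ≤ r → KK n y s < cliqueCount G s →
          ((n : ℝ) - s * y) * cliqueCount G s ≤ (s + 1) * cliqueCount G (s + 1) := by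
        intro s hs1
        induction s, hs1 using Nat.le_induction with
        | base =>
          intro _ h
          rw [cliqueCount_one', hnV] at h
          simp [KK] at h
        | succ s hs ih =>
          intro hsr h
          have hprev : ((n : ℝ) - s * y) * cliqueCount G s ≤ (s + 1) * cliqueCount G (s + 1) := by
            by_cases hc : KK n y s < cliqueCount G s
            · exact ih (by omega) hc
            · push Not at hc
              have h1 := mul_le_mul_of_nonneg_left hc (hfac s (by omega))
              have h2 := KK_succ n y s
              have h3 : ((s : ℝ) + 1) * KK n y (s + 1) ≤ (s + 1) * cliqueCount G (s + 1) := by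
                gcongr
              linarith
          have h0 : 0 < cliqueCount G (s + 1) := by
            have := (hKpos (s + 1) hsr).trans h
            exact_mod_cast this
          have := mm_step G y s hs h0 (by rw [hnV]; exact hprev)
          rw [hnV] at this
          push_cast
          linarith
      have hQ : ∀ s, t ≤ s → s ≤ r → KK n y s < cliqueCount G s := by
        intro s hs
        induction s, hs using Nat.le_induction with
        | base => intro _; exact htK
        | succ s hs ih =>
          intro hsr
          have hlt := ih (by omega)
          have h1 := hP s (by omega) (by omega) hlt
          have h2 := KK_succ n y s
          have hsr' : (s : ℝ) + 1 ≤ r := by exact_mod_cast hsr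
          have h3 : 0 < (n : ℝ) - s * y := by
            rcases le_total y 0 with h | h
            · nlinarith [(Nat.cast_nonneg s : (0 : ℝ) ≤ s)]
            · nlinarith
          have h4 := mul_lt_mul_of_pos_left hlt h3
          have h5 : ((s : ℝ) + 1) * KK n y (s + 1) < (s + 1) * cliqueCount G (s + 1) := by
            linarith
          exact lt_of_mul_lt_mul_left h5 (by positivity)
      have h1 := hQ r htr le_rfl
      have h2 := hP r (by omega) le_rfl h1
      have h3 := mul_le_mul_of_nonneg_left h1.le hpos.le
      exact mul_le_mul hμn (h3.trans h2) (mul_nonneg hpos.le (hKpos r le_rfl).le) hnR.le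
  -- final computation
  set δ := μ / n - 1 + 1 / r
  have f1 : ((r : ℝ) - 1) * n * ((r * n * δ) * ((n : ℝ) / r) ^ r) ≤
      r * (n * ((r + 1) * cliqueCount G (r + 1))) := by
    rw [← hid]
    calc _ ≤ (r * μ) * ((n - r * y) * KK n y r) := by
          refine mul_le_mul hμlow (mul_le_mul_of_nonneg_left hKr hpos.le) ?_ (by positivity)
          exact mul_nonneg hpos.le (by positivity)
      _ = r * (μ * ((n - r * y) * KK n y r)) := by ring
      _ ≤ _ := mul_le_mul_of_nonneg_left main (by linarith)
  have f2 : ((r : ℝ) - 1) * n * ((r * n * δ) * ((n : ℝ) / r) ^ r) =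
      (r * n * (r + 1)) * (δ * ((r : ℝ) * ((r : ℝ) - 1) / ((r : ℝ) + 1)) *
        ((n : ℝ) / r) ^ (r + 1)) := by
    rw [pow_succ]
    have : (r : ℝ) ≠ 0 := by linarith
    have : (r : ℝ) + 1 ≠ 0 := by linarith
    generalize ((n : ℝ) / r) ^ r = q
    generalize δ = d
    field_simp
  have f3 : (r : ℝ) * (n * ((r + 1) * cliqueCount G (r + 1))) =
      (r * n * (r + 1)) * cliqueCount G (r + 1) := by ring
  rw [f2, f3] at f1
  exact le_of_mul_le_mul_left f1 (by positivity)
end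

section
/- Let r ≥ 2 be an integer and 0 ≤ α ≤ (r−1)/r a real number. If G is a K_{r+1}-free finite simple graph of order n with μ(G) ≥ (1 − 1/r − α)·n, then the number of edges of G satisfies e(G) ≥ ((r−1)/(2r) − 2α)·n². -/
open Finset

/-- Motzkin–Straus inequality. -/
lemma motzkin_straus_aux {V : Type*} [Fintype V] [DecidableEq V]
    (G : SimpleGraph V) [DecidableRel G.Adj] (r : ℕ) (hr : 1 ≤ r)
    (hfree : G.CliqueFree (r + 1)) : ∀ (k : ℕ) (y : V → ℝ), (∀ i, 0 ≤ y i) →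
    (univ.filter (fun i => y i ≠ 0)).card ≤ k →
    y ⬝ᵥ (G.adjMatrix ℝ).mulVec y ≤ (1 - 1 / (r : ℝ)) * (∑ i, y i) ^ 2 := by
  have hr' : (0 : ℝ) < r := by exact_mod_cast hr
  intro k
  induction k with
  | zero =>
    intro y hy hk
    have h0 : y = 0 := by
      ext i
      by_contra h
      have : i ∈ univ.filter (fun i => y i ≠ 0) := by simpa using h
      have := Finset.card_pos.mpr ⟨i, this⟩
      omega
    subst h0
    simp
  | succ k ih =>
    intro y hy hk
    by_cases hc : G.IsClique (univ.filter (fun i => y i ≠ 0) : Finset V)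
    · have hcard : (univ.filter (fun i => y i ≠ 0)).card ≤ r := by
        by_contra hlt
        push Not at hlt
        obtain ⟨t, ht, htc⟩ := Finset.exists_subset_card_eq (s := univ.filter (fun i => y i ≠ 0))
          (n := r + 1) hlt
        exact hfree t ⟨hc.subset (by exact_mod_cast ht), htc⟩
      have h1 : y ⬝ᵥ (G.adjMatrix ℝ).mulVec y = (∑ i, y i) ^ 2 - ∑ i, y i ^ 2 := by
        rw [sq, Finset.sum_mul_sum, ← Finset.sum_sub_distrib]
        simp only [dotProduct, Matrix.mulVec, Finset.mul_sum]
        refine Finset.sum_congr rfl fun i _ => ?_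
        have : y i ^ 2 = ∑ j, if i = j then y i * y j else 0 := by simp [sq]
        rw [this, ← Finset.sum_sub_distrib]
        refine Finset.sum_congr rfl fun j _ => ?_
        rw [SimpleGraph.adjMatrix_apply]
        by_cases hij : i = j
        · subst hij; simp
        · by_cases hi : y i = 0
          · simp [hi]
          by_cases hj : y j = 0
          · simp [hj]
          have := hc (by simpa using hi) (by simpa using hj) hij
          simp [hij, this]
      have h2 : (∑ i, y i) ^ 2 ≤ r * ∑ i, y i ^ 2 := by
        have e1 : ∑ i, y i = ∑ i ∈ univ.filter (fun i => y i ≠ 0), y i := by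
          rw [Finset.sum_filter_ne_zero]
        have := sq_sum_le_card_mul_sum_sq (s := univ.filter (fun i => y i ≠ 0)) (f := y)
        rw [← e1] at this
        refine this.trans ?_
        have hle : ∑ i ∈ univ.filter (fun i => y i ≠ 0), y i ^ 2 ≤ ∑ i, y i ^ 2 :=
          Finset.sum_le_sum_of_subset_of_nonneg (Finset.subset_univ _) fun i _ _ => sq_nonneg _
        have : ((univ.filter (fun i => y i ≠ 0)).card : ℝ) ≤ r := by exact_mod_cast hcard
        gcongr
      rw [h1]
      have : (∑ i, y i) ^ 2 / r ≤ ∑ i, y i ^ 2 := by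
        rw [div_le_iff₀ hr']; linarith
      have e : (1 - 1 / (r : ℝ)) * (∑ i, y i) ^ 2 = (∑ i, y i) ^ 2 - (∑ i, y i) ^ 2 / r := by ring
      linarith
    · have key : ∀ u v, y u ≠ 0 → y v ≠ 0 → u ≠ v → ¬ G.Adj u v →
          (G.adjMatrix ℝ).mulVec y v ≤ (G.adjMatrix ℝ).mulVec y u →
          y ⬝ᵥ (G.adjMatrix ℝ).mulVec y ≤ (1 - 1 / (r : ℝ)) * (∑ i, y i) ^ 2 := by
        intro u v hu hv huv hadj hle
        set d : V → ℝ := Pi.single u 1 - Pi.single v 1 with hd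
        have hS : ∑ i, (y + y v • d) i = ∑ i, y i := by
          simp [hd, Finset.sum_add_distrib, ← Finset.mul_sum]
        have hsym : y ⬝ᵥ (G.adjMatrix ℝ).mulVec d = d ⬝ᵥ (G.adjMatrix ℝ).mulVec y := by
          rw [Matrix.dotProduct_mulVec, ← Matrix.mulVec_transpose,
            SimpleGraph.transpose_adjMatrix, dotProduct_comm]
        have hdy : d ⬝ᵥ (G.adjMatrix ℝ).mulVec y =
            (G.adjMatrix ℝ).mulVec y u - (G.adjMatrix ℝ).mulVec y v := by
          rw [hd, sub_dotProduct, single_one_dotProduct, single_one_dotProduct]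
        have hdd : d ⬝ᵥ (G.adjMatrix ℝ).mulVec d = 0 := by
          rw [hd, sub_dotProduct, single_one_dotProduct, single_one_dotProduct, Matrix.mulVec_sub]
          have hadj' : ¬ G.Adj v u := fun h => hadj h.symm
          simp [SimpleGraph.adjMatrix_apply, hadj, hadj']
        have h := ih (y + y v • d) ?_ ?_
        · rw [hS] at h
          rw [Matrix.mulVec_add, add_dotProduct, dotProduct_add, dotProduct_add,
            Matrix.mulVec_smul, smul_dotProduct, smul_dotProduct, dotProduct_smul,
            dotProduct_smul, hdd, hsym, hdy] at h
          simp only [smul_eq_mul] at h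
          have := mul_nonneg (hy v) (sub_nonneg.mpr hle)
          linarith
        · intro i
          by_cases hiu : i = u
          · subst hiu
            simp [hd, huv]
            linarith [hy i, hy v]
          · by_cases hiv : i = v
            · subst hiv
              simp [hd, hiu]
            · simp [hd, hiu, hiv, hy i]
        · have hsub : univ.filter (fun i => (y + y v • d) i ≠ 0) ⊆
              (univ.filter (fun i => y i ≠ 0)).erase v := by
            intro i hi
            simp only [mem_filter, mem_univ, true_and, mem_erase] at hi ⊢
            by_cases hiv : i = v
            · subst hiv
              exact absurd (by simp [hd, huv.symm]) hi
            · refine ⟨hiv, ?_⟩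
              by_cases hiu : i = u
              · rwa [hiu]
              · simpa [hd, hiu, hiv] using hi
          have h1 := Finset.card_le_card hsub
          rw [Finset.card_erase_of_mem (by simpa using hv)] at h1
          omega
      simp only [SimpleGraph.IsClique, Set.Pairwise] at hc
      push Not at hc
      obtain ⟨u, hu, v, hv, huv, hadj⟩ := hc
      have hu : y u ≠ 0 := by simpa using hu
      have hv : y v ≠ 0 := by simpa using hv
      rcases le_total ((G.adjMatrix ℝ).mulVec y v) ((G.adjMatrix ℝ).mulVec y u) with h | h
      · exact key u v hu hv huv hadj h
      · exact key v u hv hu huv.symm (fun h => hadj h.symm) h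

/-- Nikiforov's inequality for any eigenvalue. -/
lemma eigenvalue_sq_le {V : Type*} [Fintype V] [DecidableEq V]
    (G : SimpleGraph V) [DecidableRel G.Adj] (r : ℕ) (hr : 1 ≤ r)
    (hfree : G.CliqueFree (r + 1)) (i : V) :
    ((adjMatrix_isHermitian G).eigenvalues i) ^ 2 ≤
      2 * (G.edgeFinset.card : ℝ) * (1 - 1 / (r : ℝ)) := by
  set hA := adjMatrix_isHermitian G
  set x : V → ℝ := (hA.eigenvectorBasis i).ofLp with hx
  have hmul : (G.adjMatrix ℝ).mulVec x = hA.eigenvalues i • x := hA.mulVec_eigenvectorBasis i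
  have hnorm : ∑ j, x j ^ 2 = 1 := by
    have h := hA.eigenvectorBasis.orthonormal.1 i
    rw [EuclideanSpace.norm_eq, Real.sqrt_eq_one] at h
    simpa using h
  have hq : hA.eigenvalues i = ∑ p : V × V, G.adjMatrix ℝ p.1 p.2 *
      (G.adjMatrix ℝ p.1 p.2 * (x p.1 * x p.2)) := by
    have : x ⬝ᵥ (G.adjMatrix ℝ).mulVec x = hA.eigenvalues i := by
      rw [hmul, dotProduct_smul]
      have : x ⬝ᵥ x = 1 := by rw [← hnorm]; simp [dotProduct, sq]
      simp [this]
    rw [← this, Fintype.sum_prod_type]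
    simp only [dotProduct, Matrix.mulVec, Finset.mul_sum]
    refine Finset.sum_congr rfl fun a _ => Finset.sum_congr rfl fun b _ => ?_
    rw [SimpleGraph.adjMatrix_apply]
    split_ifs <;> simp
  have hcs := Finset.sum_mul_sq_le_sq_mul_sq (univ : Finset (V × V))
    (fun p => G.adjMatrix ℝ p.1 p.2) (fun p => G.adjMatrix ℝ p.1 p.2 * (x p.1 * x p.2))
  rw [← hq] at hcs
  have h1 : ∑ p : V × V, (G.adjMatrix ℝ p.1 p.2) ^ 2 = 2 * (G.edgeFinset.card : ℝ) := by
    have := G.sum_degrees_eq_twice_card_edges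
    have h' : (∑ v, (G.degree v : ℝ)) = 2 * (G.edgeFinset.card : ℝ) := by exact_mod_cast this
    rw [← h', Fintype.sum_prod_type]
    refine Finset.sum_congr rfl fun a _ => ?_
    simp [SimpleGraph.adjMatrix_apply, ← SimpleGraph.card_neighborFinset_eq_degree,
      SimpleGraph.neighborFinset_eq_filter]
  have h2 : ∑ p : V × V, (G.adjMatrix ℝ p.1 p.2 * (x p.1 * x p.2)) ^ 2 ≤ 1 - 1 / (r : ℝ) := by
    have h := motzkin_straus_aux G r hr hfree _ (fun j => x j ^ 2) (fun j => sq_nonneg _) le_rfl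
    rw [hnorm] at h
    refine le_trans (le_of_eq ?_) (h.trans (by simp))
    rw [Fintype.sum_prod_type]
    simp only [dotProduct, Matrix.mulVec, Finset.mul_sum]
    refine Finset.sum_congr rfl fun a _ => Finset.sum_congr rfl fun b _ => ?_
    rw [SimpleGraph.adjMatrix_apply]
    split_ifs <;> simp [mul_pow]
  rw [h1] at hcs
  exact hcs.trans (mul_le_mul_of_nonneg_left h2 (by positivity))

/-- For `r ≥ 2` and `0 ≤ α ≤ (r−1)/r`, if `G` is a `K_{r+1}`-free graph of order `n` with
`μ(G) ≥ (1 − 1/r − α)·n`, then `e(G) ≥ ((r−1)/(2r) − 2α)·n²`. -/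
theorem edge_count_ge_of_spectral_radius {V : Type*} [Fintype V] [DecidableEq V]
    (G : SimpleGraph V) [DecidableRel G.Adj] (r : ℕ) (hr : 2 ≤ r) (α : ℝ)
    (hα0 : 0 ≤ α) (hα1 : α ≤ ((r : ℝ) - 1) / (r : ℝ))
    (n : ℕ) (hn : n = Fintype.card V)
    (hfree : G.CliqueFree (r + 1))
    (hμ : adjSpectralRadius G ≥ (1 - 1 / (r : ℝ) - α) * n) :
    (G.edgeFinset.card : ℝ) ≥ (((r : ℝ) - 1) / (2 * r) - 2 * α) * (n : ℝ) ^ 2 := by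
  rcases isEmpty_or_nonempty V with hV | hV
  · have : n = 0 := by rw [hn]; simp
    subst this
    simp
  obtain ⟨i, hi⟩ := exists_eq_ciSup_of_finite (f := (adjMatrix_isHermitian G).eigenvalues)
  have hsq := eigenvalue_sq_le G r (by omega) hfree i
  rw [hi] at hsq
  change (adjSpectralRadius G) ^ 2 ≤ _ at hsq
  have hr2 : (2 : ℝ) ≤ r := by exact_mod_cast hr
  have hr0 : (r : ℝ) ≠ 0 := by positivity
  have e1 : ((r : ℝ) - 1) / r = 1 - 1 / r := by field_simp
  have e2 : ((r : ℝ) - 1) / (2 * r) = (1 - 1 / r) / 2 := by field_simp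
  rw [e1] at hα1
  rw [e2]
  have hc : 0 < 1 - 1 / (r : ℝ) := by
    have : 1 / (r : ℝ) ≤ 1 / 2 := one_div_le_one_div_of_le (by norm_num) hr2
    linarith
  generalize 1 - 1 / (r : ℝ) = c at *
  have h0 : 0 ≤ (c - α) * n := mul_nonneg (by linarith) (by positivity)
  have h1 : ((c - α) * n) ^ 2 ≤ 2 * (G.edgeFinset.card : ℝ) * c :=
    (pow_le_pow_left₀ h0 hμ 2).trans hsq
  have h2 : (c / 2 - 2 * α) * (n : ℝ) ^ 2 * (2 * c) ≤ (G.edgeFinset.card : ℝ) * (2 * c) := by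
    have : 0 ≤ (α ^ 2 + 2 * α * c) * (n : ℝ) ^ 2 := by positivity
    nlinarith
  exact le_of_mul_le_mul_right h2 (by positivity)
end
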